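/- Let p ≥ 5 and let τ = 1324⋯p ∈ S_p be the permutation with τ_1 = 1, τ_2 = 3, τ_3 = 2, and τ_i = i for 4 ≤ i ≤ p. Then U_{τ,1}(y) = −y, and for all n ≥ 2, U_{τ,n}(y) = (1−y)·U_{τ,n−1}(y) + Σ_{k=2}^{⌊(n−2)/(p−2)⌋+1} (−y)^{k−1} U_{τ,n−((k−1)(p−2)+1)}(y). -/

import Mathlib

open scoped Classical

noncomputable section

namespace CWilf

/-- The number of descents of a permutation of `{0, …, n-1}` (0-based). -/
def des {n : ℕ} (σ : Equiv.Perm (Fin n)) : ℕ :=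
  (Finset.univ.filter fun i : Fin n =>
    ∃ h : (i : ℕ) + 1 < n, σ ⟨(i : ℕ) + 1, h⟩ < σ i).card

/-- The number of inversions of `σ`. -/
def inv {n : ℕ} (σ : Equiv.Perm (Fin n)) : ℕ :=
  (Finset.univ.filter fun q : Fin n × Fin n => q.1 < q.2 ∧ σ q.2 < σ q.1).card

/-- The number of coinversions of `σ`. -/
def coinv {n : ℕ} (σ : Equiv.Perm (Fin n)) : ℕ :=
  (Finset.univ.filter fun q : Fin n × Fin n => q.1 < q.2 ∧ σ q.1 < σ q.2).card

/-- The number of left-to-right minima of `σ`. -/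
def LRmin {n : ℕ} (σ : Equiv.Perm (Fin n)) : ℕ :=
  (Finset.univ.filter fun j : Fin n => ∀ i : Fin n, i < j → σ j < σ i).card

/-- There is a `τ`-match of `σ` starting at (0-based) position `i`, i.e.
`red(σ_i σ_{i+1} ⋯ σ_{i+j-1}) = τ`. -/
def MatchAt {j n : ℕ} (τ : Equiv.Perm (Fin j)) (σ : Equiv.Perm (Fin n)) (i : ℕ) : Prop :=
  ∃ h : i + j ≤ n, ∀ a b : Fin j,
    τ a < τ b ↔
      σ ⟨i + (a : ℕ), by have := a.isLt; omega⟩ < σ ⟨i + (b : ℕ), by have := b.isLt; omega⟩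

/-- The number of `τ`-matches of `σ`. -/
def mch {j n : ℕ} (τ : Equiv.Perm (Fin j)) (σ : Equiv.Perm (Fin n)) : ℕ :=
  ((Finset.range n).filter fun i => MatchAt τ σ i).card

/-- `τ` is minimal overlapping: the smallest `n` such that some `σ ∈ S_n` has
exactly two `τ`-matches is `2j - 1`. -/
def MinOverlapping {j : ℕ} (τ : Equiv.Perm (Fin j)) : Prop :=
  IsLeast {n : ℕ | ∃ σ : Equiv.Perm (Fin n), mch τ σ = 2} (2 * j - 1)

/-- `α` and `β` are mutually minimal overlapping. -/
def MutuallyMinOverlapping {j : ℕ} (α β : Equiv.Perm (Fin j)) : Prop :=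
  MinOverlapping α ∧ MinOverlapping β ∧
    IsLeast {n : ℕ | ∃ σ : Equiv.Perm (Fin n), 1 ≤ mch α σ ∧ 1 ≤ mch β σ} (2 * j - 1)

/-- The set of permutations of `S_n` with no `τ`-match. -/
def NM (n : ℕ) {j : ℕ} (τ : Equiv.Perm (Fin j)) : Finset (Equiv.Perm (Fin n)) :=
  Finset.univ.filter fun σ => mch τ σ = 0


/-- `NM_{τ,n}(1,y)`, with `NM_{τ,0}(1,y) = 1` and
`NM_{τ,n}(1,y) = Σ_{σ∈NM_n(τ)} y^{des σ + 1}` for `n ≥ 1` (here `y = Polynomial.X`). -/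
def NMy {p : ℕ} (τ : Equiv.Perm (Fin p)) (n : ℕ) : Polynomial ℚ :=
  if n = 0 then 1 else ∑ σ ∈ NM n τ, Polynomial.X ^ (des σ + 1)

/-- The first `j + 1` entries of the word exist and are strictly increasing. -/
def Incr : ℕ → List ℕ → Prop
  | 0, w => w ≠ []
  | j + 1, x :: y :: r => x < y ∧ Incr j (y :: r)
  | _ + 1, _ => False

/-- The word begins with a match of `1 3 2 4 ⋯ (q + 5)`. -/
def Occ (q : ℕ) : List ℕ → Prop
  | a :: b :: c :: r => a < c ∧ c < b ∧ Incr (q + 2) (b :: r)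
  | _ => False

/-- `y ^ (des + 1)` for a nonempty word without match, `0` for a word with a match. -/
def avoidWt (q : ℕ) : List ℕ → Polynomial ℚ
  | [] => 1
  | [_] => Polynomial.X
  | a :: b :: t => if Occ q (a :: b :: t) then 0 else
      (if a < b then 1 else Polynomial.X) * avoidWt q (b :: t)

mutual

/-- The signed weight of all cluster structures on a word. -/
def cWt (q : ℕ) : List ℕ → Polynomial ℚ
  | [] => 0
  | [_] => 1
  | a :: b :: t => (if a < b then (1 - Polynomial.X) * cWt q (b :: t) else 0) + dWt q (a :: b :: t)
termination_by w => (w.length, 1)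

/-- The signed weight of the cluster structures with a marked match at the start of the word. -/
def dWt (q : ℕ) : List ℕ → Polynomial ℚ
  | a :: b :: c :: r => if a < c ∧ c < b then -Polynomial.X * eWt q (q + 1) (b :: r) else 0
  | _ => 0
termination_by w => (w.length, 0)

/-- The signed weight of the cluster structures on a word whose first `j + 2` entries are the
increasing end of a marked match. -/
def eWt (q : ℕ) : ℕ → List ℕ → Polynomial ℚ
  | 0, x :: y :: r => (if x < y then cWt q (y :: r) else 0) + dWt q (x :: y :: r)
  | j + 1, x :: y :: r => if x < y then eWt q j (y :: r) else 0
  | _, _ => 0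
termination_by _ w => (w.length, 1)

end

/-- Cut a word in two in all ways, weighting the right part by `avoidWt`. -/
def conv (q : ℕ) (f : List ℕ → Polynomial ℚ) (w : List ℕ) : Polynomial ℚ :=
  ∑ k ∈ Finset.range (w.length + 1), f (w.take k) * avoidWt q (w.drop k)

lemma conv_nil (q : ℕ) (f : List ℕ → Polynomial ℚ) : conv q f [] = f [] := by
  simp [conv, avoidWt]

lemma conv_cons (q : ℕ) (f : List ℕ → Polynomial ℚ) (a : ℕ) (t : List ℕ) :
    conv q f (a :: t) = f [] * avoidWt q (a :: t) + conv q (fun u => f (a :: u)) t := by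
  rw [conv, List.length_cons, Finset.sum_range_succ']
  simp [conv, add_comm]

lemma conv_add (q : ℕ) (f g : List ℕ → Polynomial ℚ) (w : List ℕ) :
    conv q (fun u => f u + g u) w = conv q f w + conv q g w := by
  simp [conv, add_mul, Finset.sum_add_distrib]

lemma conv_mul (q : ℕ) (z : Polynomial ℚ) (f : List ℕ → Polynomial ℚ) (w : List ℕ) :
    conv q (fun u => z * f u) w = z * conv q f w := by
  simp [conv, mul_assoc, Finset.mul_sum]

lemma conv_zero (q : ℕ) (w : List ℕ) : conv q (fun _ => 0) w = 0 := by
  simp [conv]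

lemma conv_cons_of_nil (q : ℕ) {f : List ℕ → Polynomial ℚ} (hf : f [] = 0) (a : ℕ) (t : List ℕ) :
    conv q f (a :: t) = conv q (fun u => f (a :: u)) t := by
  rw [conv_cons, hf, zero_mul, zero_add]

lemma cWt_nil (q : ℕ) : cWt q [] = 0 := by rw [cWt]
lemma cWt_singleton (q a : ℕ) : cWt q [a] = 1 := by rw [cWt]
lemma cWt_cons_cons (q a b : ℕ) (t : List ℕ) : cWt q (a :: b :: t) =
    (if a < b then (1 - Polynomial.X) * cWt q (b :: t) else 0) + dWt q (a :: b :: t) := by rw [cWt]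
lemma dWt_nil (q : ℕ) : dWt q [] = 0 := by rw [dWt]; simp
lemma dWt_singleton (q a : ℕ) : dWt q [a] = 0 := by rw [dWt]; simp
lemma dWt_pair (q a b : ℕ) : dWt q [a, b] = 0 := by rw [dWt]; simp
lemma dWt_cons (q a b c : ℕ) (r : List ℕ) : dWt q (a :: b :: c :: r) =
    if a < c ∧ c < b then -Polynomial.X * eWt q (q + 1) (b :: r) else 0 := by rw [dWt]
lemma eWt_nil (q j : ℕ) : eWt q j [] = 0 := by rw [eWt] <;> simp
lemma eWt_singleton (q j a : ℕ) : eWt q j [a] = 0 := by rw [eWt] <;> simp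
lemma eWt_zero_cons (q x y : ℕ) (r : List ℕ) : eWt q 0 (x :: y :: r) =
    (if x < y then cWt q (y :: r) else 0) + dWt q (x :: y :: r) := by rw [eWt]
lemma eWt_succ_cons (q j x y : ℕ) (r : List ℕ) : eWt q (j + 1) (x :: y :: r) =
    if x < y then eWt q j (y :: r) else 0 := by rw [eWt]

lemma lt_of_occ {q a b : ℕ} {t : List ℕ} (h : Occ q (a :: b :: t)) : a < b := by
  cases t with
  | nil => exact h.elim
  | cons c r => exact h.1.trans h.2.1

lemma avoidWt_of_incr {q j : ℕ} {x y : ℕ} {r : List ℕ} (h : Incr (j + 2) (x :: y :: r)) :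
    avoidWt q (x :: y :: r) = avoidWt q (y :: r) := by
  have hxy : x < y := h.1
  cases r with
  | nil => exact h.2.elim
  | cons z s =>
    have hyz : y < z := h.2.1
    rw [avoidWt, if_neg, if_pos hxy, one_mul]
    rintro ⟨-, h2, -⟩
    exact h2.not_gt hyz

lemma conv_identities (q n : ℕ) : ∀ w : List ℕ, w.length ≤ n →
    (w ≠ [] → Polynomial.X * conv q (cWt q) w = avoidWt q w) ∧
    (Polynomial.X * conv q (dWt q) w = -(if Occ q w then avoidWt q w.tail else 0)) ∧
    ∀ j, Polynomial.X * conv q (eWt q j) w = if Incr (j + 1) w then avoidWt q w else 0 := by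
  induction n with
  | zero =>
    intro w hw
    obtain rfl : w = [] := by simpa using hw
    simp [conv_nil, dWt_nil, eWt_nil, Occ, Incr]
  | succ n ih =>
    intro w hw
    match w with
    | [] => simp [conv_nil, dWt_nil, eWt_nil, Occ, Incr]
    | [a] =>
      simp [conv_cons, conv_nil, cWt_nil, cWt_singleton, dWt_nil, dWt_singleton, eWt_nil,
        eWt_singleton, Occ, Incr, avoidWt]
    | a :: b :: t =>
      obtain ⟨ihc, -, ihe⟩ := ih (b :: t) (by simpa using hw)
      specialize ihc (by simp)
      have hd : Polynomial.X * conv q (dWt q) (a :: b :: t) =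
          -(if Occ q (a :: b :: t) then avoidWt q (b :: t) else 0) := by
        rw [conv_cons_of_nil q (dWt_nil q), conv_cons_of_nil q (dWt_singleton q a)]
        cases t with
        | nil => simp [conv_nil, dWt_pair, Occ]
        | cons c r =>
          rw [conv_cons_of_nil q (dWt_pair q a b)]
          simp only [dWt_cons]
          by_cases h : a < c ∧ c < b
          · simp only [if_pos h]
            have he := (ih (b :: r) (by simp at hw ⊢; omega)).2.2 (q + 1)
            rw [conv_mul, ← conv_cons_of_nil q (eWt_nil q (q + 1)), mul_left_comm, he]
            by_cases hi : Incr (q + 2) (b :: r)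
            · rw [if_pos hi, if_pos (show Occ q (a :: b :: c :: r) from ⟨h.1, h.2, hi⟩)]
              rw [avoidWt, if_neg (fun ho => (lt_of_occ ho).not_gt h.2), if_neg h.2.not_gt]
              cases r with
              | nil => exact hi.elim
              | cons d s =>
                rw [avoidWt_of_incr hi, avoidWt_of_incr (j := q) (x := c) ⟨h.2.trans hi.1, hi.2⟩]
                ring
            · rw [if_neg hi, if_neg (fun ho : Occ q (a :: b :: c :: r) => hi ho.2.2)]
              simp
          · simp only [if_neg h]
            rw [conv_zero, if_neg (fun ho : Occ q (a :: b :: c :: r) => h ⟨ho.1, ho.2.1⟩)]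
            simp
      refine ⟨fun _ => ?_, hd, fun j => ?_⟩
      · have key : conv q (cWt q) (a :: b :: t) = avoidWt q (b :: t) +
            (if a < b then (1 - Polynomial.X) * conv q (cWt q) (b :: t) else 0) +
            conv q (dWt q) (a :: b :: t) := by
          rw [conv_cons_of_nil q (cWt_nil q), conv_cons, cWt_singleton, one_mul,
            conv_cons_of_nil q (dWt_nil q) a,
            conv_cons_of_nil q (f := fun u => dWt q (a :: u)) (dWt_singleton q a), add_assoc]
          simp only [cWt_cons_cons]
          rw [conv_add]
          by_cases h : a < b
          · simp only [if_pos h]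
            rw [conv_mul, ← conv_cons_of_nil q (cWt_nil q)]
          · simp only [if_neg h, conv_zero]
        rw [key, mul_add, mul_add, hd, avoidWt]
        by_cases h : a < b
        · rw [if_pos h, mul_left_comm, ihc, if_pos h]
          split_ifs <;> ring
        · have hn : ¬ Occ q (a :: b :: t) := fun ho => h (lt_of_occ ho)
          rw [if_neg h, if_neg hn, if_neg hn, if_neg h]
          simp
      · cases j with
        | zero =>
          have key : conv q (eWt q 0) (a :: b :: t) =
              (if a < b then conv q (cWt q) (b :: t) else 0) + conv q (dWt q) (a :: b :: t) := by
            rw [conv_cons_of_nil q (eWt_nil q 0), conv_cons_of_nil q (eWt_singleton q 0 a),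
              conv_cons_of_nil q (dWt_nil q) a,
              conv_cons_of_nil q (f := fun u => dWt q (a :: u)) (dWt_singleton q a)]
            simp only [eWt_zero_cons]
            rw [conv_add]
            by_cases h : a < b
            · simp only [if_pos h]
              rw [← conv_cons_of_nil q (cWt_nil q)]
            · simp only [if_neg h, conv_zero]
          rw [key, mul_add, hd, avoidWt]
          by_cases h : a < b
          · rw [if_pos h, ihc, if_pos h,
              if_pos (show Incr 1 (a :: b :: t) from ⟨h, by simp [Incr]⟩)]
            split_ifs <;> ring
          · have hn : ¬ Occ q (a :: b :: t) := fun ho => h (lt_of_occ ho)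
            rw [if_neg h, if_neg hn, if_neg (fun hi : Incr 1 (a :: b :: t) => h hi.1)]
            simp
        | succ j =>
          have key : conv q (eWt q (j + 1)) (a :: b :: t) =
              if a < b then conv q (eWt q j) (b :: t) else 0 := by
            rw [conv_cons_of_nil q (eWt_nil q _), conv_cons_of_nil q (eWt_singleton q _ a)]
            simp only [eWt_succ_cons]
            by_cases h : a < b
            · simp only [if_pos h]
              rw [← conv_cons_of_nil q (eWt_nil q j)]
            · simp only [if_neg h, conv_zero]
          rw [key]
          by_cases h : a < b
          · rw [if_pos h, ihe]
            by_cases hi : Incr (j + 1) (b :: t)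
            · have hi' : Incr (j + 2) (a :: b :: t) := ⟨h, hi⟩
              rw [if_pos hi, if_pos hi', avoidWt_of_incr hi']
            · rw [if_neg hi, if_neg (fun hi' : Incr (j + 2) (a :: b :: t) => hi hi'.2)]
          · rw [if_neg h, if_neg (fun hi' : Incr (j + 2) (a :: b :: t) => h hi'.1), mul_zero]

/-- The arrangements of a finite set as words without repetition. -/
def words (S : Finset ℕ) : Finset (List ℕ) := S.toList.permutations.toFinset

lemma mem_words {S : Finset ℕ} {l : List ℕ} : l ∈ words S ↔ l.Nodup ∧ ∀ x, x ∈ l ↔ x ∈ S := by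
  rw [words, List.mem_toFinset, List.mem_permutations]
  constructor
  · intro h
    exact ⟨h.nodup_iff.2 S.nodup_toList, fun x => by rw [h.mem_iff, Finset.mem_toList]⟩
  · rintro ⟨hn, h⟩
    exact (List.perm_ext_iff_of_nodup hn S.nodup_toList).2 fun x => by rw [h, Finset.mem_toList]

lemma length_of_mem_words {S : Finset ℕ} {l : List ℕ} (h : l ∈ words S) : l.length = S.card := by
  obtain ⟨hn, h⟩ := mem_words.1 h
  rw [← List.toFinset_card_of_nodup hn]
  congr 1
  ext x
  simp [h]

lemma words_empty : words ∅ = {[]} := by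
  ext l
  rw [mem_words, Finset.mem_singleton]
  constructor
  · rintro ⟨-, h⟩
    exact List.eq_nil_iff_forall_not_mem.2 fun x hx => by simpa using (h x).1 hx
  · rintro rfl
    simp

lemma cons_mem_words {S : Finset ℕ} {a : ℕ} {t : List ℕ} :
    a :: t ∈ words S ↔ a ∈ S ∧ t ∈ words (S.erase a) := by
  simp only [mem_words, List.nodup_cons, List.mem_cons, Finset.mem_erase]
  constructor
  · rintro ⟨⟨ha, ht⟩, h⟩
    refine ⟨(h a).1 (Or.inl rfl), ht, fun x => ⟨fun hx => ⟨?_, (h x).1 (Or.inr hx)⟩, ?_⟩⟩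
    · rintro rfl
      exact ha hx
    · rintro ⟨hx, hS⟩
      exact ((h x).2 hS).resolve_left hx
  · rintro ⟨ha, ht, h⟩
    refine ⟨⟨fun hat => ((h a).1 hat).1 rfl, ht⟩, fun x => ⟨?_, fun hx => ?_⟩⟩
    · rintro (rfl | hx)
      exacts [ha, ((h x).1 hx).2]
    · by_cases hxa : x = a
      exacts [Or.inl hxa, Or.inr ((h x).2 ⟨hxa, hx⟩)]

lemma sum_words_eq_sum_cons {S : Finset ℕ} (hS : S.Nonempty) (f : List ℕ → Polynomial ℚ) :
    ∑ l ∈ words S, f l = ∑ a ∈ S, ∑ t ∈ words (S.erase a), f (a :: t) := by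
  rw [Finset.sum_sigma']
  symm
  refine Finset.sum_bij (fun x _ => x.1 :: x.2) ?_ ?_ ?_ (fun _ _ => rfl)
  · rintro ⟨a, t⟩ h
    exact cons_mem_words.2 (Finset.mem_sigma.1 h)
  · rintro ⟨a, t⟩ - ⟨a', t'⟩ - h
    simp only [List.cons.injEq] at h
    obtain ⟨rfl, rfl⟩ := h
    rfl
  · intro l hl
    cases l with
    | nil =>
      obtain ⟨x, hx⟩ := hS
      simpa using ((mem_words.1 hl).2 x).2 hx
    | cons a t => exact ⟨⟨a, t⟩, Finset.mem_sigma.2 (cons_mem_words.1 hl), rfl⟩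

lemma sum_words_conv (q : ℕ) (S : Finset ℕ) (f : List ℕ → Polynomial ℚ) :
    ∑ l ∈ words S, conv q f l =
      ∑ T ∈ S.powerset, (∑ u ∈ words T, f u) * ∑ v ∈ words (S \ T), avoidWt q v := by
  simp only [conv, Finset.sum_mul_sum, ← Finset.sum_product']
  rw [Finset.sum_sigma', Finset.sum_sigma']
  symm
  refine Finset.sum_bij (fun x _ => ⟨x.2.1 ++ x.2.2, x.2.1.length⟩) ?_ ?_ ?_ ?_
  · rintro ⟨T, u, v⟩ h
    simp only [Finset.mem_sigma, Finset.mem_powerset, Finset.mem_product, mem_words,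
      Finset.mem_sdiff] at h
    obtain ⟨hT, ⟨hu, hu'⟩, hv, hv'⟩ := h
    simp only [Finset.mem_sigma, Finset.mem_range, mem_words, List.mem_append, List.length_append]
    refine ⟨⟨List.nodup_append'.2 ⟨hu, hv, fun x hx hx' => ?_⟩, fun x => ?_⟩, by omega⟩
    · exact ((hv' x).1 hx').2 ((hu' x).1 hx)
    · rw [hu', hv']
      have := @hT x
      tauto
  · rintro ⟨T, u, v⟩ h ⟨T', u', v'⟩ h' he
    simp only [Sigma.mk.injEq, heq_eq_eq] at he
    obtain ⟨rfl, rfl⟩ := List.append_inj he.1 he.2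
    simp only [Finset.mem_sigma, Finset.mem_product, mem_words] at h h'
    obtain rfl : T = T' := by
      ext x
      rw [← h.2.1.2, ← h'.2.1.2]
    rfl
  · rintro ⟨l, k⟩ h
    simp only [Finset.mem_sigma, Finset.mem_range, mem_words] at h
    obtain ⟨⟨hn, hl⟩, hk⟩ := h
    have hs : l.take k ++ l.drop k = l := List.take_append_drop k l
    have hn' := hn
    rw [← hs, List.nodup_append'] at hn'
    obtain ⟨h1, h2, h3⟩ := hn'
    have hmem : ∀ x, x ∈ S ↔ x ∈ l.take k ∨ x ∈ l.drop k := fun x => by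
      rw [← hl, ← List.mem_append, hs]
    refine ⟨⟨(l.take k).toFinset, l.take k, l.drop k⟩, ?_, ?_⟩
    · simp only [Finset.mem_sigma, Finset.mem_powerset, Finset.mem_product, mem_words,
        Finset.mem_sdiff, List.mem_toFinset]
      refine ⟨fun x hx => (hmem x).2 (Or.inl (List.mem_toFinset.1 hx)), ⟨h1, fun _ => trivial⟩,
        h2, fun x => ?_⟩
      rw [hmem]
      have := @h3 x
      tauto
    · simp only [hs, List.length_take, Sigma.mk.injEq, heq_eq_eq, true_and]
      omega
  · rintro ⟨T, u, v⟩ h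
    simp

lemma weights_min_head (q n : ℕ) : ∀ a t, (a :: t).length ≤ n →
    (dWt q (a :: t) ≠ 0 → ∀ x ∈ t, a < x) ∧ (cWt q (a :: t) ≠ 0 → ∀ x ∈ t, a < x) ∧
    ∀ j, eWt q j (a :: t) ≠ 0 → ∀ x ∈ t, a < x := by
  induction n with
  | zero => simp
  | succ n ih =>
    intro a t ht
    match t with
    | [] => simp
    | b :: t =>
      obtain ⟨-, ihc, ihe⟩ := ih b t (by simpa using ht)
      have hd : dWt q (a :: b :: t) ≠ 0 → ∀ x ∈ b :: t, a < x := by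
        cases t with
        | nil => simp [dWt_pair]
        | cons c r =>
          rw [dWt_cons]
          split_ifs with h
          · intro hne
            have := (ih b r (by simp at ht ⊢; omega)).2.2 (q + 1) (right_ne_zero_of_mul hne)
            simp only [List.mem_cons]
            rintro x (rfl | rfl | hx)
            exacts [h.1.trans h.2, h.1, (h.1.trans h.2).trans (this x hx)]
          · simp
      refine ⟨hd, fun hc => ?_, fun j he => ?_⟩
      · by_cases hz : dWt q (a :: b :: t) = 0
        · rw [cWt_cons_cons, hz, add_zero] at hc
          split_ifs at hc with h
          · have := ihc (right_ne_zero_of_mul hc)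
            simp only [List.mem_cons]
            rintro x (rfl | hx)
            exacts [h, h.trans (this x hx)]
          · simp at hc
        · exact hd hz
      · by_cases hz : dWt q (a :: b :: t) = 0
        · have hlt : a < b ∧ ∀ x ∈ t, b < x := by
            cases j with
            | zero =>
              rw [eWt_zero_cons, hz, add_zero] at he
              split_ifs at he with h
              · exact ⟨h, ihc he⟩
              · simp at he
            | succ j =>
              rw [eWt_succ_cons] at he
              split_ifs at he with h
              · exact ⟨h, ihe j he⟩
              · simp at he
          simp only [List.mem_cons]
          rintro x (rfl | hx)
          exacts [hlt.1, hlt.1.trans (hlt.2 x hx)]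
        · exact hd hz

lemma sum_words_of_min_head {S : Finset ℕ} {m : ℕ} (hm : m ∈ S) (hmin : ∀ x ∈ S, m ≤ x)
    {f : List ℕ → Polynomial ℚ} (hf : ∀ a t, f (a :: t) ≠ 0 → ∀ x ∈ t, a < x) :
    ∑ l ∈ words S, f l = ∑ t ∈ words (S.erase m), f (m :: t) := by
  rw [sum_words_eq_sum_cons ⟨m, hm⟩]
  refine Finset.sum_eq_single_of_mem m hm fun a ha ham => Finset.sum_eq_zero fun t ht => ?_
  by_contra hne
  have := hf a t hne m (((mem_words.1 ht).2 m).2 (Finset.mem_erase.2 ⟨ham.symm, hm⟩))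
  exact (hmin a ha).not_gt this

mutual

/-- The sum of `cWt` over all arrangements of an `n`-element set. -/
def cNum (q : ℕ) : ℕ → Polynomial ℚ
  | 0 => 0
  | 1 => 1
  | n + 2 => (1 - Polynomial.X) * cNum q (n + 1) + dNum q (n + 2)
termination_by n => (n, 1)

/-- The sum of `dWt` over all arrangements of an `n`-element set. -/
def dNum (q : ℕ) (n : ℕ) : Polynomial ℚ :=
  if n < q + 4 then 0 else
    -Polynomial.X * (cNum q (n - (q + 4)) + dNum q (n - (q + 3)))
termination_by (n, 0)

end

/-- The sum of `eWt` over all arrangements of an `n`-element set. -/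
def eNum (q j n : ℕ) : Polynomial ℚ :=
  if n ≤ j then 0 else cNum q (n - j - 1) + dNum q (n - j)

lemma cNum_zero (q : ℕ) : cNum q 0 = 0 := by rw [cNum]
lemma cNum_one (q : ℕ) : cNum q 1 = 1 := by rw [cNum]
lemma cNum_add_two (q n : ℕ) :
    cNum q (n + 2) = (1 - Polynomial.X) * cNum q (n + 1) + dNum q (n + 2) := by rw [cNum]
lemma dNum_of_lt {q n : ℕ} (h : n < q + 4) : dNum q n = 0 := by rw [dNum, if_pos h]
lemma dNum_add (q n : ℕ) :
    dNum q (n + (q + 4)) = -Polynomial.X * (cNum q n + dNum q (n + 1)) := by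
  rw [dNum, if_neg (by omega), Nat.add_sub_cancel, show n + (q + 4) - (q + 3) = n + 1 by omega]

lemma eNum_eq_dNum (q n : ℕ) : dNum q (n + 2) = -Polynomial.X * eNum q (q + 1) n := by
  rw [eNum]
  split_ifs with h
  · rw [dNum_of_lt (by omega), mul_zero]
  · obtain ⟨m, rfl⟩ : ∃ m, n = m + (q + 2) := ⟨n - (q + 2), by omega⟩
    rw [show m + (q + 2) + 2 = m + (q + 4) by ring, dNum_add,
      show m + (q + 2) - (q + 1) - 1 = m by omega, show m + (q + 2) - (q + 1) = m + 1 by omega]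

lemma lt_of_mem_words_erase_min {S : Finset ℕ} {m : ℕ} (hmin : ∀ x ∈ S, m ≤ x) {b : ℕ}
    {t : List ℕ} (h : b :: t ∈ words (S.erase m)) : m < b := by
  obtain ⟨h1, h2⟩ := Finset.mem_erase.1 (cons_mem_words.1 h).1
  exact lt_of_le_of_ne (hmin b h2) (Ne.symm h1)

lemma sum_words_dWt_cons {q m c : ℕ} {R : Finset ℕ} (hc : c ∈ R) (hcmin : ∀ x ∈ R, c ≤ x)
    (hmc : m < c) : ∑ t ∈ words R, dWt q (m :: t) =
      -Polynomial.X * ∑ l ∈ words (R.erase c), eWt q (q + 1) l := by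
  have hzero : ∑ t ∈ words (R.erase c), dWt q (m :: c :: t) = 0 := by
    refine Finset.sum_eq_zero fun t ht => ?_
    cases t with
    | nil => exact dWt_pair q m c
    | cons d r =>
      rw [dWt_cons, if_neg]
      exact fun h => h.2.not_gt (lt_of_mem_words_erase_min hcmin ht)
  rw [sum_words_eq_sum_cons ⟨c, hc⟩, ← Finset.add_sum_erase R _ hc, hzero, zero_add]
  rcases (R.erase c).eq_empty_or_nonempty with he | hne
  · simp [he, words_empty, eWt_nil]
  rw [sum_words_eq_sum_cons hne, Finset.mul_sum]
  refine Finset.sum_congr rfl fun b hb => ?_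
  obtain ⟨hbc, hbR⟩ := Finset.mem_erase.1 hb
  rw [sum_words_of_min_head (m := c) (f := fun t => dWt q (m :: b :: t)), Finset.mul_sum,
    Finset.erase_right_comm]
  · refine Finset.sum_congr rfl fun r _ => ?_
    rw [dWt_cons, if_pos ⟨hmc, lt_of_le_of_ne (hcmin b hbR) hbc.symm⟩]
  · exact Finset.mem_erase.2 ⟨hbc.symm, hc⟩
  · exact fun x hx => hcmin x (Finset.mem_erase.1 hx).2
  · intro d r hne x hx
    simp only [dWt_cons] at hne
    split_ifs at hne with h
    · exact h.2.trans ((weights_min_head q _ b r le_rfl).2.2 _ (right_ne_zero_of_mul hne) x hx)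
    · simp at hne

lemma sum_words_weights (q n : ℕ) : ∀ S : Finset ℕ, S.card = n →
    ∑ l ∈ words S, dWt q l = dNum q n ∧ ∑ l ∈ words S, cWt q l = cNum q n ∧
    ∀ j, ∑ l ∈ words S, eWt q j l = eNum q j n := by
  induction n using Nat.strong_induction_on with
  | _ n ih =>
    intro S hS
    rcases Nat.eq_zero_or_pos n with rfl | hn
    · obtain rfl := Finset.card_eq_zero.1 hS
      simp [words_empty, dWt_nil, cWt_nil, eWt_nil, cNum_zero, dNum_of_lt, eNum]
    have hne : S.Nonempty := Finset.card_pos.1 (by omega)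
    obtain ⟨m, hm, hmin⟩ : ∃ m ∈ S, ∀ x ∈ S, m ≤ x :=
      ⟨S.min' hne, S.min'_mem hne, fun x hx => S.min'_le x hx⟩
    have hcard : (S.erase m).card = n - 1 := by rw [Finset.card_erase_of_mem hm, hS]
    obtain ⟨-, ihc, ihe⟩ := ih (n - 1) (by omega) _ hcard
    have hd : ∑ l ∈ words S, dWt q l = dNum q n := by
      rw [sum_words_of_min_head hm hmin fun a t => (weights_min_head q _ a t le_rfl).1]
      rcases Nat.lt_or_ge n 2 with h2 | h2
      · obtain rfl : n = 1 := by omega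
        rw [Finset.card_eq_zero.1 hcard, words_empty, Finset.sum_singleton, dWt_singleton,
          dNum_of_lt (by omega)]
      obtain ⟨k, rfl⟩ : ∃ k, n = k + 2 := ⟨n - 2, by omega⟩
      have hne' : (S.erase m).Nonempty := Finset.card_pos.1 (by omega)
      obtain ⟨c, hc, hcmin⟩ : ∃ c ∈ S.erase m, ∀ x ∈ S.erase m, c ≤ x :=
        ⟨_, (S.erase m).min'_mem hne', fun x hx => (S.erase m).min'_le x hx⟩
      have hmc : m < c := lt_of_le_of_ne (hmin c (Finset.mem_erase.1 hc).2)
        (Finset.mem_erase.1 hc).1.symm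
      have hcard' : ((S.erase m).erase c).card = k := by
        rw [Finset.card_erase_of_mem hc, hcard]
        omega
      rw [eNum_eq_dNum, ← (ih k (by omega) _ hcard').2.2 (q + 1)]
      exact sum_words_dWt_cons hc hcmin hmc
    refine ⟨hd, ?_, fun j => ?_⟩
    · obtain ⟨k, rfl⟩ : ∃ k, n = k + 1 := ⟨n - 1, by omega⟩
      cases k with
      | zero =>
        rw [sum_words_of_min_head hm hmin fun a t => (weights_min_head q _ a t le_rfl).2.1,
          Finset.card_eq_zero.1 hcard, words_empty, Finset.sum_singleton, cWt_singleton, cNum_one]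
      | succ k =>
        rw [cNum_add_two, ← hd,
          sum_words_of_min_head hm hmin fun a t => (weights_min_head q _ a t le_rfl).2.1,
          sum_words_of_min_head hm hmin fun a t => (weights_min_head q _ a t le_rfl).1]
        simp only [Nat.add_sub_cancel] at ihc hcard
        rw [← ihc, Finset.mul_sum, ← Finset.sum_add_distrib]
        refine Finset.sum_congr rfl fun t ht => ?_
        cases t with
        | nil => simpa [hcard] using length_of_mem_words ht
        | cons b t => rw [cWt_cons_cons, if_pos (lt_of_mem_words_erase_min hmin ht)]
    · obtain ⟨k, rfl⟩ : ∃ k, n = k + 1 := ⟨n - 1, by omega⟩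
      simp only [Nat.add_sub_cancel] at ihc ihe hcard
      rw [sum_words_of_min_head hm hmin fun a t => (weights_min_head q _ a t le_rfl).2.2 j]
      cases j with
      | zero =>
        rw [eNum, if_neg (by omega), Nat.sub_zero, ← hd, Nat.add_sub_cancel, ← ihc,
          sum_words_of_min_head hm hmin fun a t => (weights_min_head q _ a t le_rfl).1,
          ← Finset.sum_add_distrib]
        refine Finset.sum_congr rfl fun t ht => ?_
        cases t with
        | nil => simp [eWt_singleton, cWt_nil, dWt_singleton]
        | cons b t => rw [eWt_zero_cons, if_pos (lt_of_mem_words_erase_min hmin ht)]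
      | succ j =>
        have : eNum q (j + 1) (k + 1) = eNum q j k := by
          simp [eNum]
        rw [this, ← ihe]
        refine Finset.sum_congr rfl fun t ht => ?_
        cases t with
        | nil => simp [eWt_singleton, eWt_nil]
        | cons b t => rw [eWt_succ_cons, if_pos (lt_of_mem_words_erase_min hmin ht)]

lemma incr_iff (j : ℕ) (w : List ℕ) : Incr j w ↔
    j < w.length ∧ ∀ i < j, w.getD i 0 < w.getD (i + 1) 0 := by
  induction j generalizing w with
  | zero => simp [Incr, List.length_pos_iff]
  | succ j ih =>
    match w with
    | [] => simp [Incr]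
    | [a] => simp [Incr]
    | x :: y :: r =>
      rw [Incr, ih, Nat.forall_lt_succ_left']
      simp
      tauto

lemma occ_iff (q : ℕ) (w : List ℕ) : Occ q w ↔
    q + 5 ≤ w.length ∧ w.getD 0 0 < w.getD 2 0 ∧ w.getD 2 0 < w.getD 1 0 ∧
      w.getD 1 0 < w.getD 3 0 ∧ ∀ i < q + 1, w.getD (i + 3) 0 < w.getD (i + 4) 0 := by
  match w with
  | [] => simp [Occ]
  | [a] => simp [Occ]
  | [a, b] => simp [Occ]
  | a :: b :: c :: r =>
    rw [Occ, incr_iff, Nat.forall_lt_succ_left']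
    simp
    constructor
    · rintro ⟨h1, h2, h3, h4, h5⟩
      exact ⟨by omega, h1, h2, h4, h5⟩
    · rintro ⟨h1, h2, h3, h4, h5⟩
      exact ⟨h2, h3, by omega, h4, h5⟩

lemma avoidWt_eq (q : ℕ) (w : List ℕ) (hw : w ≠ []) : avoidWt q w =
    if ∃ i, Occ q (w.drop i) then 0 else
      Polynomial.X ^ (((Finset.range (w.length - 1)).filter
        fun i => ¬ w.getD i 0 < w.getD (i + 1) 0).card + 1) := by
  induction w with
  | nil => exact absurd rfl hw
  | cons a t ih =>
    have hex : (∃ i, Occ q ((a :: t).drop i)) ↔ Occ q (a :: t) ∨ ∃ i, Occ q (t.drop i) := by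
      constructor
      · rintro ⟨i, hi⟩
        cases i with
        | zero => exact Or.inl hi
        | succ i => exact Or.inr ⟨i, hi⟩
      · rintro (h | ⟨i, hi⟩)
        exacts [⟨0, h⟩, ⟨i + 1, hi⟩]
    cases t with
    | nil =>
      rw [if_neg]
      · simp [avoidWt]
      · rw [hex]
        simp [Occ]
    | cons b t =>
      rw [avoidWt, ih (by simp)]
      by_cases h1 : Occ q (a :: b :: t)
      · rw [if_pos h1, if_pos (hex.2 (Or.inl h1))]
      rw [if_neg h1]
      by_cases h2 : ∃ i, Occ q ((b :: t).drop i)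
      · rw [if_pos h2, if_pos (hex.2 (Or.inr h2)), mul_zero]
      rw [if_neg h2, if_neg (fun h => (hex.1 h).elim h1 h2)]
      have hcard : ((Finset.range ((a :: b :: t).length - 1)).filter
          fun i => ¬ (a :: b :: t).getD i 0 < (a :: b :: t).getD (i + 1) 0).card =
          ((Finset.range ((b :: t).length - 1)).filter
            fun i => ¬ (b :: t).getD i 0 < (b :: t).getD (i + 1) 0).card +
          (if a < b then 0 else 1) := by
        simp only [Finset.card_filter, List.length_cons, Nat.add_sub_cancel]
        rw [Finset.sum_range_succ']
        congr 1
        simp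
        by_cases h : a < b
        · simp [h]
        · simp [h, not_lt.1 h]
      rw [hcard]
      split_ifs <;> ring

/-- The one-line notation of a permutation. -/
def toWord {n : ℕ} (σ : Equiv.Perm (Fin n)) : List ℕ := List.ofFn fun i => (σ i : ℕ)

lemma getD_toWord {n : ℕ} (σ : Equiv.Perm (Fin n)) {i : ℕ} (h : i < n) :
    (toWord σ).getD i 0 = σ ⟨i, h⟩ := by
  rw [List.getD_eq_getElem _ _ (by simpa [toWord] using h)]
  simp [toWord]

lemma matchAt_iff {n q : ℕ} (σ : Equiv.Perm (Fin n)) (i : ℕ) :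
    MatchAt (Equiv.swap (⟨1, by omega⟩ : Fin (q + 5)) ⟨2, by omega⟩) σ i ↔
      Occ q ((toWord σ).drop i) := by
  set τ := Equiv.swap (⟨1, by omega⟩ : Fin (q + 5)) ⟨2, by omega⟩ with hτ
  have hlen : (toWord σ).length = n := by simp [toWord]
  have τ1 : τ ⟨1, by omega⟩ = ⟨2, by omega⟩ := Equiv.swap_apply_left _ _
  have τ2 : τ ⟨2, by omega⟩ = ⟨1, by omega⟩ := Equiv.swap_apply_right _ _
  have τ' : ∀ k (hk : k < q + 5), k ≠ 1 → k ≠ 2 → τ ⟨k, hk⟩ = ⟨k, hk⟩ := fun k hk h1 h2 =>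
    Equiv.swap_apply_of_ne_of_ne (by simpa using h1) (by simpa using h2)
  have hd : ∀ k, ((toWord σ).drop i).getD k 0 = (toWord σ).getD (i + k) 0 := fun k => by
    simp [List.getD_eq_getElem?_getD]
  rw [occ_iff]
  simp only [hd, List.length_drop, hlen]
  constructor
  · rintro ⟨h, hm⟩
    have key : ∀ k l (hk : k < q + 5) (hl : l < q + 5), τ ⟨k, hk⟩ < τ ⟨l, hl⟩ →
        (toWord σ).getD (i + k) 0 < (toWord σ).getD (i + l) 0 := by
      intro k l hk hl hlt
      rw [getD_toWord σ (by omega), getD_toWord σ (by omega)]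
      exact (hm ⟨k, hk⟩ ⟨l, hl⟩).1 hlt
    have t0 := τ' 0 (by omega) (by omega) (by omega)
    have t3 := τ' 3 (by omega) (by omega) (by omega)
    refine ⟨by omega, key 0 2 (by omega) (by omega) ?_, key 2 1 (by omega) (by omega) ?_,
      key 1 3 (by omega) (by omega) ?_, fun k hk => key (k + 3) (k + 4) (by omega) (by omega) ?_⟩
    · rw [t0, τ2]; exact Fin.mk_lt_mk.2 (by omega)
    · rw [τ1, τ2]; exact Fin.mk_lt_mk.2 (by omega)
    · rw [τ1, t3]; exact Fin.mk_lt_mk.2 (by omega)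
    · rw [τ' _ _ (by omega) (by omega), τ' _ _ (by omega) (by omega)]; simp
  · rintro ⟨h, h02, h21, h13, hc⟩
    refine ⟨by omega, ?_⟩
    have hmono : StrictMono fun a : Fin (q + 5) => (toWord σ).getD (i + (τ a : ℕ)) 0 := by
      rw [Fin.strictMono_iff_lt_succ]
      rintro ⟨k, hk⟩
      simp only [Fin.castSucc_mk, Fin.succ_mk]
      match k, hk with
      | 0, hk => rw [τ' 0 (by omega) (by omega) (by omega), τ1]; exact h02
      | 1, hk => rw [τ1, τ2]; exact h21
      | 2, hk => rw [τ2, τ' 3 (by omega) (by omega) (by omega)]; exact h13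
      | k + 3, hk =>
        rw [τ' (k + 3) (by omega) (by omega) (by omega),
          τ' (k + 4) (by omega) (by omega) (by omega)]
        exact hc k (by omega)
    intro a b
    have := hmono.lt_iff_lt (a := τ a) (b := τ b)
    simp only [hτ, Equiv.swap_apply_self] at this
    rw [← hτ] at this
    rw [← this, getD_toWord σ (by have := a.isLt; omega), getD_toWord σ (by have := b.isLt; omega),
      Fin.val_fin_lt]

lemma avoidWt_toWord {n q : ℕ} (hn : 0 < n) (σ : Equiv.Perm (Fin n)) :
    avoidWt q (toWord σ) =
      if mch (Equiv.swap (⟨1, by omega⟩ : Fin (q + 5)) ⟨2, by omega⟩) σ = 0 then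
        Polynomial.X ^ (des σ + 1) else 0 := by
  have hlen : (toWord σ).length = n := by simp [toWord]
  rw [avoidWt_eq _ _ (List.ne_nil_of_length_pos (by omega)), hlen, ← ite_not]
  congr 1
  · rw [mch, Finset.card_eq_zero, Finset.filter_eq_empty_iff, eq_iff_iff, not_exists]
    simp only [matchAt_iff, Finset.mem_range]
    refine ⟨fun h i _ => h i, fun h i hi => ?_⟩
    by_cases hin : i < n
    · exact h hin hi
    · rw [List.drop_eq_nil_of_le (by omega)] at hi
      exact hi
  · congr 2
    rw [des]
    symm
    refine Finset.card_bij (fun i _ => (i : ℕ)) ?_ (fun _ _ _ _ h => Fin.ext h) ?_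
    · intro i hi
      obtain ⟨h, hlt⟩ := (Finset.mem_filter.1 hi).2
      rw [Finset.mem_filter, Finset.mem_range, getD_toWord σ i.isLt, getD_toWord σ h]
      exact ⟨by omega, not_lt.2 (le_of_lt hlt)⟩
    · intro i hi
      rw [Finset.mem_filter, Finset.mem_range] at hi
      obtain ⟨hi, hle⟩ := hi
      have h : i + 1 < n := by omega
      rw [getD_toWord σ (by omega), getD_toWord σ h, not_lt, Fin.val_fin_le] at hle
      refine ⟨⟨i, by omega⟩, Finset.mem_filter.2 ⟨Finset.mem_univ _, h, ?_⟩, rfl⟩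
      refine lt_of_le_of_ne hle fun he => ?_
      simpa using σ.injective he

lemma sum_toWord (n : ℕ) (f : List ℕ → Polynomial ℚ) :
    ∑ σ : Equiv.Perm (Fin n), f (toWord σ) = ∑ l ∈ words (Finset.range n), f l := by
  refine Finset.sum_bij (fun σ _ => toWord σ) ?_ ?_ ?_ fun _ _ => rfl
  · intro σ _
    rw [mem_words]
    refine ⟨List.nodup_ofFn.2 fun i j h => σ.injective (Fin.ext h), fun x => ?_⟩
    rw [toWord, List.mem_ofFn, Finset.mem_range]
    constructor
    · rintro ⟨i, rfl⟩
      exact (σ i).isLt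
    · exact fun h => ⟨σ.symm ⟨x, h⟩, by simp⟩
  · intro σ _ σ' _ h
    ext i
    exact congrFun (List.ofFn_injective h) i
  · intro l hl
    have hlen := length_of_mem_words hl
    rw [Finset.card_range] at hlen
    subst hlen
    obtain ⟨hnd, hmem⟩ := mem_words.1 hl
    let g : Fin l.length → Fin l.length :=
      fun i => ⟨l[i], Finset.mem_range.1 ((hmem _).1 (l.getElem_mem i.isLt))⟩
    have hg : Function.Injective g := fun i j h =>
      Fin.ext ((hnd.getElem_inj_iff).1 (congrArg Fin.val h))
    refine ⟨Equiv.ofBijective g (Finite.injective_iff_bijective.1 hg), Finset.mem_univ _, ?_⟩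
    simp [toWord, g]

lemma sum_words_avoidWt_of_forall_lt {q n : ℕ} (hn : 0 < n) {A : ℕ → Polynomial ℚ}
    (hA : ∀ m < n, ∀ S : Finset ℕ, S.card = m → ∑ l ∈ words S, avoidWt q l = A m)
    {S : Finset ℕ} (hS : S.card = n) : ∑ l ∈ words S, avoidWt q l =
      Polynomial.X * ∑ k ∈ Finset.range (n + 1),
        (n.choose k : Polynomial ℚ) * cNum q k * A (n - k) := by
  have hconv : ∑ l ∈ words S, avoidWt q l =
      Polynomial.X * ∑ l ∈ words S, conv q (cWt q) l := by
    rw [Finset.mul_sum]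
    refine Finset.sum_congr rfl fun l hl => ((conv_identities q _ l le_rfl).1 ?_).symm
    rintro rfl
    have := length_of_mem_words hl
    rw [List.length_nil] at this
    omega
  have hsplit : ∑ l ∈ words S, conv q (cWt q) l =
      ∑ T ∈ S.powerset, cNum q T.card * A (n - T.card) := by
    rw [sum_words_conv]
    refine Finset.sum_congr rfl fun T hT => ?_
    rw [Finset.mem_powerset] at hT
    rw [(sum_words_weights q _ T rfl).2.1]
    rcases Nat.eq_zero_or_pos T.card with h0 | h0
    · rw [h0, cNum_zero, zero_mul, zero_mul]
    · have := Finset.card_le_card hT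
      rw [hA (n - T.card) (by omega) _ (by rw [Finset.card_sdiff_of_subset hT, hS])]
  rw [hconv, hsplit, Finset.sum_powerset_apply_card fun k => cNum q k * A (n - k), hS]
  simp only [nsmul_eq_mul, mul_assoc]

lemma sum_words_avoidWt_eq_range (q n : ℕ) : ∀ S : Finset ℕ, S.card = n →
    ∑ l ∈ words S, avoidWt q l = ∑ l ∈ words (Finset.range n), avoidWt q l := by
  induction n using Nat.strong_induction_on with
  | _ n ih =>
    intro S hS
    rcases Nat.eq_zero_or_pos n with rfl | hn
    · rw [Finset.card_eq_zero.1 hS, Finset.range_zero]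
    · rw [sum_words_avoidWt_of_forall_lt hn ih hS,
        sum_words_avoidWt_of_forall_lt hn ih (Finset.card_range n)]

lemma sum_words_avoidWt {q n : ℕ} {S : Finset ℕ} (hS : S.card = n) :
    ∑ l ∈ words S, avoidWt q l =
      NMy (Equiv.swap (⟨1, by omega⟩ : Fin (q + 5)) ⟨2, by omega⟩) n := by
  rw [sum_words_avoidWt_eq_range q n S hS]
  rcases Nat.eq_zero_or_pos n with rfl | hn
  · simp [words_empty, avoidWt, NMy]
  · rw [← sum_toWord, NMy, if_neg hn.ne', NM, Finset.sum_filter]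
    exact Finset.sum_congr rfl fun σ _ => avoidWt_toWord hn σ

lemma NMy_recursion (q : ℕ) {n : ℕ} (hn : 0 < n) :
    NMy (Equiv.swap (⟨1, by omega⟩ : Fin (q + 5)) ⟨2, by omega⟩) n =
      Polynomial.X * ∑ k ∈ Finset.range (n + 1), (n.choose k : Polynomial ℚ) * cNum q k *
        NMy (Equiv.swap (⟨1, by omega⟩ : Fin (q + 5)) ⟨2, by omega⟩) (n - k) := by
  rw [← sum_words_avoidWt (Finset.card_range n)]
  exact sum_words_avoidWt_of_forall_lt hn (fun _ _ _ hS => sum_words_avoidWt hS)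
    (Finset.card_range n)

/-- The coefficients of the reciprocal of `1 / (1 - z C(t))` are those of `1 - z C(t)`. -/
lemma eq_neg_mul_of_recursions {R : Type*} [CommRing R] {z : R} {U A C : ℕ → R} (hU0 : U 0 = 1)
    (hA0 : A 0 = 1) (hC0 : C 0 = 0)
    (hU : ∀ n, 0 < n → ∑ k ∈ Finset.range (n + 1), (n.choose k : R) * U k * A (n - k) = 0)
    (hA : ∀ n, 0 < n →
      A n = z * ∑ k ∈ Finset.range (n + 1), (n.choose k : R) * C k * A (n - k))
    {n : ℕ} (hn : 0 < n) : U n = -z * C n := by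
  induction n using Nat.strong_induction_on with
  | _ n ih =>
    obtain ⟨m, rfl⟩ : ∃ m, n = m + 1 := ⟨n - 1, by omega⟩
    have hu := hU (m + 1) hn
    have ha := hA (m + 1) hn
    rw [Finset.sum_range_succ, Finset.sum_range_succ'] at hu ha
    have hs : ∑ k ∈ Finset.range m, ((m + 1).choose (k + 1) : R) * U (k + 1) *
        A (m + 1 - (k + 1)) = -z * ∑ k ∈ Finset.range m, ((m + 1).choose (k + 1) : R) *
        C (k + 1) * A (m + 1 - (k + 1)) := by
      rw [Finset.mul_sum]
      refine Finset.sum_congr rfl fun k hk => ?_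
      rw [ih (k + 1) (by have := Finset.mem_range.1 hk; omega) (by omega)]
      ring
    rw [hs] at hu
    simp only [Nat.choose_zero_right, Nat.choose_self, Nat.sub_self, hA0, hU0, hC0,
      Nat.sub_zero] at hu ha
    push_cast at hu ha
    linear_combination hu - ha

lemma dNum_eq_sum_range (q n : ℕ) (hn : 2 ≤ n) : dNum q n =
    ∑ j ∈ Finset.range ((n - 2) / (q + 3)),
      (-Polynomial.X) ^ (j + 1) * cNum q (n - ((j + 1) * (q + 3) + 1)) := by
  induction n using Nat.strong_induction_on with
  | _ n ih =>
    rcases Nat.lt_or_ge n (q + 5) with h | h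
    · rw [Nat.div_eq_of_lt (by omega), Finset.range_zero, Finset.sum_empty]
      rcases Nat.lt_or_ge n (q + 4) with h' | h'
      · exact dNum_of_lt h'
      · obtain rfl : n = 0 + (q + 4) := by omega
        rw [dNum_add, cNum_zero, dNum_of_lt (by omega), add_zero, mul_zero]
    · obtain ⟨m, rfl⟩ : ∃ m, n = m + 1 + (q + 4) := ⟨n - (q + 5), by omega⟩
      rw [dNum_add, ih (m + 2) (by omega) (by omega),
        show m + 1 + (q + 4) - 2 = m + (q + 3) by omega, Nat.add_div_right m (by omega),
        Finset.sum_range_succ', show m + 1 + (q + 4) - ((0 + 1) * (q + 3) + 1) = m + 1 by omega,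
        Nat.add_sub_cancel, mul_add, Finset.mul_sum, zero_add, pow_one, add_comm]
      congr 1
      refine Finset.sum_congr rfl fun j _ => ?_
      rw [show m + 1 + (q + 4) - ((j + 1 + 1) * (q + 3) + 1) = m + 2 - ((j + 1) * (q + 3) + 1) by
        rw [add_mul (j + 1)]; omega]
      ring

/-- Theorem (Jones–Remmel): let `p ≥ 5` and let `τ = 1324⋯p ∈ S_p`, i.e. the
permutation fixing every position except that it sends position `2` to `3` and
position `3` to `2` (1-based); 0-based this is `Equiv.swap 1 2`.  If
`U : ℕ → ℚ[y]` satisfies `U 0 = 1` and `Σ_{k=0}^n C(n,k) U_k NM_{τ,n-k}(1,y) = 0`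
for `n ≥ 1`, then `U 1 = -y` and, for all `n ≥ 2`,
`U n = (1-y) U (n-1) + Σ_{k=2}^{⌊(n-2)/(p-2)⌋+1} (-y)^{k-1} U (n-((k-1)(p-2)+1))`. -/
theorem stmt17 {p : ℕ} (hp : 5 ≤ p)
    (τ : Equiv.Perm (Fin p))
    (hτ : τ = Equiv.swap ⟨1, by omega⟩ ⟨2, by omega⟩)
    (U : ℕ → Polynomial ℚ) (hU0 : U 0 = 1)
    (hUdef : ∀ n : ℕ, 1 ≤ n →
      ∑ k ∈ Finset.range (n + 1),
        (Nat.choose n k : Polynomial ℚ) * U k * NMy τ (n - k) = 0) :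
    U 1 = -Polynomial.X ∧
    ∀ n : ℕ, 2 ≤ n →
      U n = (1 - Polynomial.X) * U (n - 1) +
        ∑ k ∈ Finset.Icc 2 ((n - 2) / (p - 2) + 1),
          (-Polynomial.X) ^ (k - 1) * U (n - ((k - 1) * (p - 2) + 1)) := by
  obtain ⟨q, rfl⟩ : ∃ q, p = q + 5 := ⟨p - 5, by omega⟩
  subst hτ
  have hU : ∀ n, 0 < n → U n = -Polynomial.X * cNum q n := fun n hn =>
    eq_neg_mul_of_recursions hU0 (by simp [NMy]) (cNum_zero q) (fun n hn => hUdef n hn)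
      (fun n hn => NMy_recursion q hn) hn
  refine ⟨by rw [hU 1 one_pos, cNum_one, mul_one], fun n hn => ?_⟩
  obtain ⟨m, rfl⟩ : ∃ m, n = m + 2 := ⟨n - 2, by omega⟩
  rw [hU _ (by omega), show m + 2 - 1 = m + 1 by omega, hU _ (by omega), cNum_add_two,
    dNum_eq_sum_range q _ (by omega), Nat.add_sub_cancel, show q + 5 - 2 = q + 3 by omega,
    mul_add, mul_left_comm, ← Finset.Ico_add_one_right_eq_Icc, Finset.sum_Ico_eq_sum_range,
    show m / (q + 3) + 1 + 1 - 2 = m / (q + 3) from rfl, Finset.mul_sum]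
  congr 1
  refine Finset.sum_congr rfl fun j hj => ?_
  have hle : (j + 1) * (q + 3) ≤ m :=
    (Nat.mul_le_mul_right _ (Finset.mem_range.1 hj)).trans (Nat.div_mul_le_self m (q + 3))
  rw [show 2 + j - 1 = j + 1 by omega, hU _ (by omega)]
  ring

end CWilf
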